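/- Define elements ε_n of the Grossman–Larson algebra ℚT by ε_0 = • and ε_n = Σ_{j=1}^{n} (−1)^{j−1} κ_j ∘ ε_{n−j} for n ≥ 1, where κ_j = Σ_{t : |t| = j+1} t/|Sym(t)| and ∘ is the Grossman–Larson product. Then for every n ≥ 0, n!·ε_n = t_{1^n}, the corolla B_+(• • ⋯ •) whose root has exactly n children, each a leaf. -/

import Mathlib

/-! ### Planar rooted trees -/

/-- A planar rooted tree: a root with an ordered list of branches.
`PTree.node [T₁,…,T_k]` is `B₊(T₁⋯T_k)`; `PTree.node []` is the one-vertex tree `•`. -/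
inductive PTree : Type where
  | node : List PTree → PTree

instance : Inhabited PTree := ⟨.node []⟩

noncomputable instance : DecidableEq PTree := Classical.decEq _

/-- Number of vertices of a planar rooted tree. -/
def PTree.size : PTree → ℕ
  | .node l => 1 + (l.attach.map (fun x => PTree.size x.1)).sum
decreasing_by
  have h := List.sizeOf_lt_of_mem x.2
  simp only [PTree.node.sizeOf_spec]
  omega

/-! ### Rooted trees -/

/-- Isomorphism of the underlying rooted trees: the lists of branches agree
up to permutation and recursive isomorphism. -/
inductive PTree.Equiv : PTree → PTree → Prop where
  | node {l m m' : List PTree} :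
      List.Forall₂ PTree.Equiv l m' → List.Perm m' m → PTree.Equiv (.node l) (.node m)

/-- Rooted trees: planar rooted trees modulo isomorphism. -/
def RTree : Type := Quot PTree.Equiv

/-- The underlying rooted tree of a planar rooted tree. -/
def toR : PTree → RTree := Quot.mk _

/-- A choice of planar representative of a rooted tree. -/
noncomputable def RTree.out : RTree → PTree := Quot.out

noncomputable instance : DecidableEq RTree := Classical.decEq _

/-- The order of the symmetry group of (the underlying rooted tree of) a planar
rooted tree: `|Sym(B₊(t₁⋯t_k))| = (∏_s m_s!)·∏ᵢ |Sym(tᵢ)|`, where `m_s` is the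
multiplicity of the isomorphism type `s` among the branches `t₁,…,t_k`. -/
noncomputable def PTree.symOrder : PTree → ℕ
  | .node l =>
      (l.attach.map (fun x => PTree.symOrder x.1)).prod *
      (((l.map toR : List RTree) : Multiset RTree).toFinset.prod
        (fun s => (Multiset.count s (l.map toR : Multiset RTree)).factorial))
decreasing_by
  have h := List.sizeOf_lt_of_mem x.2
  simp only [PTree.node.sizeOf_spec]
  omega

/-- The order of the symmetry group of a rooted tree. -/
noncomputable def RTree.sym (t : RTree) : ℕ := t.out.symOrder

/-- Number of vertices of a rooted tree. -/
noncomputable def RTree.size (t : RTree) : ℕ := t.out.size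

/-- `B₊` for rooted trees: attach a new root to a multiset forest. -/
noncomputable def RTree.node (m : Multiset RTree) : RTree :=
  toR (PTree.node (m.toList.map RTree.out))

/-- The one-vertex rooted tree `•`. -/
noncomputable def RTree.bullet : RTree := toR (.node [])

/-! ### The Grossman–Larson product -/

namespace PTree

mutual
/-- The list of vertices of a planar rooted tree, as paths from the root. -/
def positions : PTree → List (List ℕ)
  | .node l => [] :: positionsList 0 l
/-- Vertices of the trees in a forest, as paths (first coordinate = index in forest). -/
def positionsList : ℕ → List PTree → List (List ℕ)
  | _, [] => []
  | i, t :: ts => (positions t).map (i :: ·) ++ positionsList (i+1) ts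
end

/-- Attach the tree `s` by a new edge to the vertex of a tree at the given path
(as a new last child). -/
def attachAt (s : PTree) : PTree → List ℕ → PTree
  | .node l, [] => .node (l ++ [s])
  | .node l, i :: p => .node (l.set i (attachAt s l[i]! p))

/-- Attach several trees at given vertices, in order. -/
def attachMany : PTree → List (List ℕ × PTree) → PTree
  | t, [] => t
  | t, (p, s) :: rest => attachMany (attachAt s t p) rest

end PTree

/-- Grossman–Larson product of planar representatives, with values in the free
`k`-module on rooted trees: for `t = B₊(t₁⋯t_n)` and a tree `t'` with `m`
vertices, the sum of the `m^n` rooted trees obtained by attaching each `tᵢ`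
to a vertex of `t'`. -/
noncomputable def glMulP (k : Type*) [Semiring k] (t t' : PTree) : RTree →₀ k :=
  match t with
  | .node l =>
    (((List.replicate l.length (PTree.positions t')).sections).map
      (fun ps => Finsupp.single (toR (PTree.attachMany t' (ps.zip l))) (1 : k))).sum

/-- Grossman–Larson product of rooted trees. -/
noncomputable def glMul (k : Type*) [Semiring k] (a b : RTree) : RTree →₀ k :=
  glMulP k a.out b.out

/-- Bilinear extension of the Grossman–Larson product to the free module `kT`. -/
noncomputable def glMulF {k : Type*} [CommSemiring k] (f g : RTree →₀ k) : RTree →₀ k :=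
  f.sum (fun a x => g.sum (fun b y => (x * y) • glMul k a b))

/-! ### Enumeration of planar trees by size -/

mutual
/-- All planar rooted trees with exactly `n` vertices. -/
def treesOfSize : ℕ → List PTree
  | 0 => []
  | n + 1 => (forestsOfSize n).map PTree.node
  termination_by n => 2 * n
  decreasing_by omega
/-- All ordered forests of planar rooted trees with `n` vertices in total. -/
def forestsOfSize : ℕ → List (List PTree)
  | 0 => [[]]
  | n + 1 =>
      ((List.range (n + 1)).attach.map (fun j =>
        (treesOfSize (j.1 + 1)).flatMap (fun t =>
          (forestsOfSize (n - j.1)).map (t :: ·)))).flatten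
  termination_by n => 2 * n + 1
  decreasing_by
  · have hj := List.mem_range.mp j.2; omega
  · have hj := List.mem_range.mp j.2; omega
end

/-- All rooted trees with exactly `n` vertices. -/
noncomputable def allRTrees (n : ℕ) : List RTree := ((treesOfSize n).map toR).dedup

/-- `e(t)`: the number of planar rooted trees whose underlying rooted tree is `t`. -/
noncomputable def eCount (t : RTree) : ℕ :=
  ((treesOfSize t.size).filter (fun T => toR T = t)).length

/-- `κ_n = Σ_{|t| = n+1} t / |Sym(t)|`, the sum over all rooted trees with `n+1`
vertices; in particular `κ_0 = •`. -/
noncomputable def kappa (n : ℕ) : RTree →₀ ℚ :=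
  ((allRTrees (n + 1)).map (fun t => Finsupp.single t (((RTree.sym t : ℚ))⁻¹))).sum

/-- `ε_0 = •` and `ε_n = Σ_{j=1}^n (−1)^{j−1} κ_j ∘ ε_{n−j}` for `n ≥ 1`. -/
noncomputable def eps : ℕ → (RTree →₀ ℚ)
  | 0 => Finsupp.single RTree.bullet 1
  | n + 1 => ∑ j ∈ Finset.range (n + 1), ((-1 : ℚ)) ^ j • glMulF (kappa (j + 1)) (eps (n - j))
decreasing_by omega

namespace PTree

lemma size_node (l : List PTree) : (node l).size = 1 + (l.map size).sum := by
  simp [size]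

lemma symOrder_node (l : List PTree) :
    (node l).symOrder = (l.map symOrder).prod *
      ((l.map toR : List RTree) : Multiset RTree).toFinset.prod
        (fun s => (Multiset.count s (l.map toR : Multiset RTree)).factorial) := by
  simp [symOrder]

/-- Structural induction on planar trees. -/
lemma induction_on_branches {p : PTree → Prop} (h : ∀ l, (∀ t ∈ l, p t) → p (node l))
    (t : PTree) : p t := by
  induction hn : sizeOf t using Nat.strong_induction_on generalizing t with
  | _ n ih =>
    cases t with
    | node l =>
      refine h l fun t ht => ih (sizeOf t) ?_ t rfl
      have := List.sizeOf_lt_of_mem ht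
      simp only [node.sizeOf_spec] at hn
      omega

lemma equiv_refl (t : PTree) : Equiv t t := by
  induction t using induction_on_branches with
  | h l ih => exact .node (List.forall₂_same.2 ih) (List.Perm.refl l)

/-- A function on planar trees computed from the unordered branches is an isomorphism invariant. -/
lemma Equiv.apply_eq {β : Type*} (f : PTree → β) (g : Multiset (RTree × β) → β)
    (hf : ∀ l, f (PTree.node l) = g (l.map fun x => (toR x, f x) : List (RTree × β)))
    {s t : PTree} (h : Equiv s t) : f s = f t := by
  induction s using induction_on_branches generalizing t with
  | h l ih =>
    obtain ⟨h₁, h₂⟩ := h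
    rename_i m' m
    rw [hf, hf]
    congr 1
    rw [Multiset.coe_eq_coe]
    refine List.Perm.trans (List.Perm.of_eq ?_) (h₂.map _)
    clear hf h₂
    induction h₁ with
    | nil => rfl
    | cons hab _ ih' =>
      simp only [List.map_cons, List.cons.injEq, Prod.mk.injEq]
      exact ⟨⟨Quot.sound hab, ih _ (by simp) hab⟩, ih' fun t ht => ih t (by simp [ht])⟩

end PTree

namespace RTree

lemma toR_out (t : RTree) : toR t.out = t := Quot.out_eq t

lemma toR_node_congr_aux (r : List PTree) {l m : List PTree} (h : l.map toR = m.map toR) :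
    toR (.node (r ++ l)) = toR (.node (r ++ m)) := by
  induction l generalizing m r with
  | nil => cases m <;> simp_all
  | cons a l ih =>
    cases m with
    | nil => simp at h
    | cons b m =>
      simp only [List.map_cons, List.cons.injEq] at h
      have key : toR (.node (r ++ a :: l)) = toR (.node (r ++ b :: l)) := by
        let φ : RTree → RTree := Quot.lift (fun x => toR (.node (r ++ x :: l))) (by
          intro x y hxy
          refine Quot.sound (.node (m' := r ++ y :: l) ?_ (List.Perm.refl _))
          exact List.rel_append (List.forall₂_same.2 fun t _ => PTree.equiv_refl t)
            (.cons hxy (List.forall₂_same.2 fun t _ => PTree.equiv_refl t)))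
        exact congrArg φ h.1
      rw [key]
      simpa using ih (r ++ [b]) h.2

lemma toR_node_congr {l m : List PTree} (h : (l.map toR).Perm (m.map toR)) :
    toR (.node l) = toR (.node m) := by
  obtain ⟨l', h', hl'⟩ : Relation.Comp (· = List.map toR ·) List.Perm (m.map toR) l := by
    rw [List.eq_map_comp_perm]
    exact h.symm
  refine (Quot.sound (.node (m' := l) ?_ hl'.symm)).trans (toR_node_congr_aux [] h'.symm)
  exact List.forall₂_same.2 fun t _ => PTree.equiv_refl t

/-- The multiset of branches at the root. -/
def children : RTree → Multiset RTree :=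
  Quot.lift (fun | .node l => (l.map toR : List RTree)) (by
    rintro _ _ ⟨h₁, h₂⟩
    rename_i l m' m
    simp only [Multiset.coe_eq_coe]
    refine List.Perm.trans (List.Perm.of_eq ?_) (h₂.map _)
    clear h₂
    induction h₁ with
    | nil => rfl
    | cons hab _ ih => simp only [List.map_cons, ih, show toR _ = toR _ from Quot.sound hab])

lemma children_toR (l : List PTree) : (toR (.node l)).children = (l.map toR : List RTree) := rfl

lemma node_map_toR (l : List PTree) : node (l.map toR : List RTree) = toR (.node l) := by
  refine toR_node_congr ?_
  rw [List.map_map, show toR ∘ out = id from funext toR_out, List.map_id, ← Multiset.coe_eq_coe,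
    Multiset.coe_toList]

lemma node_children (t : RTree) : node t.children = t := by
  rw [← toR_out t]
  cases t.out with
  | node l => rw [children_toR, node_map_toR]

lemma exists_list (M : Multiset RTree) : ∃ l : List PTree, M = (l.map toR : List RTree) := by
  refine ⟨M.toList.map out, ?_⟩
  rw [List.map_map, show toR ∘ out = id from funext toR_out, List.map_id, Multiset.coe_toList]

lemma children_node (M : Multiset RTree) : (node M).children = M := by
  obtain ⟨l, rfl⟩ := exists_list M
  rw [node_map_toR, children_toR]

lemma size_toR (t : PTree) : (toR t).size = t.size := by
  have h := congrArg (Quot.lift PTree.size fun _ _ => PTree.Equiv.apply_eq PTree.size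
    (fun m => 1 + (m.map Prod.snd).sum) fun l => by
      simp [PTree.size_node, Function.comp_def]) (toR_out (toR t))
  exact h

lemma sym_toR (t : PTree) : (toR t).sym = t.symOrder := by
  have h := congrArg (Quot.lift PTree.symOrder fun _ _ => PTree.Equiv.apply_eq PTree.symOrder
    (fun m => (m.map Prod.snd).prod * (m.map Prod.fst).toFinset.prod
      (fun s => (Multiset.count s (m.map Prod.fst)).factorial)) fun l => by
      simp [PTree.symOrder_node, Function.comp_def]) (toR_out (toR t))
  exact h

lemma size_node (M : Multiset RTree) : (node M).size = 1 + (M.map size).sum := by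
  obtain ⟨l, rfl⟩ := exists_list M
  rw [node_map_toR, size_toR, PTree.size_node]
  simp [Function.comp_def, size_toR]

lemma sym_node (M : Multiset RTree) :
    (node M).sym = (M.map sym).prod * ∏ s ∈ M.toFinset, (M.count s).factorial := by
  obtain ⟨l, rfl⟩ := exists_list M
  rw [node_map_toR, sym_toR, PTree.symOrder_node]
  simp [Function.comp_def, sym_toR]

lemma sym_node_zero : (node 0).sym = 1 := by simp [sym_node]

lemma sym_node_cons (a : RTree) (M : Multiset RTree) :
    (node (a ::ₘ M)).sym = a.sym * (M.count a + 1) * (node M).sym := by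
  have key : ∏ s ∈ (a ::ₘ M).toFinset, ((a ::ₘ M).count s).factorial
      = (M.count a + 1) * ∏ s ∈ M.toFinset, (M.count s).factorial := by
    rw [Finset.prod_subset (s₁ := M.toFinset) (s₂ := (a ::ₘ M).toFinset)
      (by intro x; simp; tauto)
      (by intro x _ hx; rw [Multiset.count_eq_zero_of_notMem (by simpa using hx)]; rfl)]
    have ha : a ∈ (a ::ₘ M).toFinset := by simp
    rw [← Finset.mul_prod_erase _ _ ha, ← Finset.mul_prod_erase _ _ ha, Multiset.count_cons_self,
      Nat.factorial_succ, mul_assoc]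
    congr 2
    refine Finset.prod_congr rfl fun x hx => ?_
    rw [Multiset.count_cons_of_ne (Finset.ne_of_mem_erase hx)]
  rw [sym_node, sym_node, key]
  simp only [Multiset.map_cons, Multiset.prod_cons]
  ring

lemma sym_pos (t : RTree) : 0 < t.sym := by
  rw [← toR_out t]
  induction t.out using PTree.induction_on_branches with
  | h l ih =>
    rw [← node_map_toR, sym_node]
    refine Nat.mul_pos (Nat.pos_of_ne_zero ?_) (Finset.prod_pos fun s _ => Nat.factorial_pos _)
    intro h0
    simp only [Multiset.map_coe, Multiset.prod_coe, List.prod_eq_zero_iff, List.mem_map] at h0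
    obtain ⟨_, ⟨t, ht, rfl⟩, h⟩ := h0
    exact (ih t ht).ne' h

lemma size_pos (t : RTree) : 0 < t.size := by
  rw [← node_children t, size_node]; omega

end RTree

lemma PTree.size_pos (t : PTree) : 0 < t.size := by
  cases t with
  | node l => rw [PTree.size_node]; omega

lemma mem_treesOfSize_and_mem_forestsOfSize (n : ℕ) :
    (∀ t, t ∈ treesOfSize n ↔ t.size = n) ∧
      ∀ l, l ∈ forestsOfSize n ↔ (l.map PTree.size).sum = n := by
  induction n using Nat.strong_induction_on with
  | _ n ih =>
    cases n with
    | zero =>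
      refine ⟨fun t => ?_, fun l => ?_⟩
      · simpa [treesOfSize] using t.size_pos.ne'
      · cases l with
        | nil => simp [forestsOfSize]
        | cons t l =>
          have := t.size_pos
          simp [forestsOfSize]
          omega
    | succ n =>
      have htree : ∀ t, t ∈ treesOfSize (n + 1) ↔ t.size = n + 1 := by
        rintro ⟨l⟩
        simp only [treesOfSize, List.mem_map, PTree.node.injEq, exists_eq_right,
          (ih n (by omega)).2, PTree.size_node]
        omega
      have htree' : ∀ k ≤ n + 1, ∀ t, t ∈ treesOfSize k ↔ t.size = k := fun k hk =>
        hk.lt_or_eq.elim (fun h => (ih k h).1) (fun h => h ▸ htree)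
      refine ⟨htree, fun l => ?_⟩
      rw [forestsOfSize]
      simp only [List.mem_flatten, List.mem_map, List.mem_attach, true_and, Subtype.exists,
        List.mem_range]
      constructor
      · rintro ⟨_, ⟨j, hj, rfl⟩, hl⟩
        simp only [List.mem_flatMap, List.mem_map] at hl
        obtain ⟨t, ht, l', hl', rfl⟩ := hl
        rw [htree' _ (by omega)] at ht
        rw [(ih _ (by omega)).2] at hl'
        simp only [List.map_cons, List.sum_cons]
        omega
      · intro hl
        cases l with
        | nil => simp at hl
        | cons t l =>
          have := t.size_pos
          simp only [List.map_cons, List.sum_cons] at hl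
          refine ⟨_, ⟨t.size - 1, by omega, rfl⟩, ?_⟩
          simp only [List.mem_flatMap, List.mem_map]
          refine ⟨t, ?_, l, ?_, rfl⟩
          · rw [htree' _ (by omega)]; omega
          · rw [(ih _ (by omega)).2]; omega

lemma mem_allRTrees (n : ℕ) (t : RTree) : t ∈ allRTrees n ↔ t.size = n := by
  simp only [allRTrees, List.mem_dedup, List.mem_map, (mem_treesOfSize_and_mem_forestsOfSize n).1]
  constructor
  · rintro ⟨T, hT, rfl⟩
    rw [RTree.size_toR, hT]
  · intro h
    exact ⟨t.out, h, t.toR_out⟩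

/-- The forests with `n` vertices in total. -/
noncomputable def forests (n : ℕ) : Finset (Multiset RTree) :=
  (allRTrees (n + 1)).toFinset.image RTree.children

lemma mem_forests {n : ℕ} {M : Multiset RTree} : M ∈ forests n ↔ (M.map RTree.size).sum = n := by
  simp only [forests, Finset.mem_image, List.mem_toFinset, mem_allRTrees]
  constructor
  · rintro ⟨t, ht, rfl⟩
    rw [← t.node_children, RTree.size_node] at ht
    omega
  · intro h
    exact ⟨RTree.node M, by rw [RTree.size_node]; omega, RTree.children_node M⟩

/-- The weight `1 / |Sym(B₊(M))|` of a forest `M`. -/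
noncomputable def forestWeight (M : Multiset RTree) : ℚ := ((RTree.node M).sym : ℚ)⁻¹

lemma kappa_eq_sum_forests (n : ℕ) :
    kappa n = ∑ M ∈ forests n, Finsupp.single (RTree.node M) (forestWeight M) := by
  rw [forests, Finset.sum_image (fun s _ t _ h => by
    rw [← s.node_children, h, t.node_children])]
  simp only [forestWeight, RTree.node_children]
  exact (List.sum_toFinset _ (List.nodup_dedup _)).symm

lemma count_antidiagonal_aux {a : RTree} {A B M : Multiset RTree} (h : A + B = a ::ₘ M)
    (ih : ∀ A B : Multiset RTree, A + B = M → M.antidiagonal.count (A, B) * (RTree.node A).sym *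
      (RTree.node B).sym = (RTree.node M).sym) :
    (M.antidiagonal.map (Prod.map id (a ::ₘ ·))).count (A, B) * (RTree.node A).sym *
      (RTree.node B).sym = a.sym * B.count a * (RTree.node M).sym := by
  by_cases hB : a ∈ B
  · obtain ⟨B, rfl⟩ := Multiset.exists_cons_of_mem hB
    have hinj : Function.Injective
        (Prod.map id (a ::ₘ ·) : Multiset RTree × Multiset RTree → _) :=
      Function.injective_id.prodMap (fun _ _ => (Multiset.cons_inj_right a).1)
    rw [show (A, a ::ₘ B) = Prod.map id (a ::ₘ ·) (A, B) from rfl,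
      Multiset.count_map_eq_count' _ _ hinj, RTree.sym_node_cons, Multiset.count_cons_self,
      ← ih A B (by simpa [Multiset.add_cons] using h)]
    ring
  · rw [Multiset.count_eq_zero_of_notMem (a := a) hB, Multiset.count_eq_zero_of_notMem]
    · simp
    · simp only [Multiset.mem_map, Prod.exists, Prod.map_apply, Prod.mk.injEq, not_exists]
      rintro A' B' ⟨_, _, rfl⟩
      simp at hB

lemma count_antidiagonal_mul_sym (A B M : Multiset RTree) (h : A + B = M) :
    M.antidiagonal.count (A, B) * (RTree.node A).sym * (RTree.node B).sym =
      (RTree.node M).sym := by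
  induction M using Multiset.induction generalizing A B with
  | empty =>
    obtain ⟨rfl, rfl⟩ : A = 0 ∧ B = 0 := by simpa using h
    simp [RTree.sym_node_zero]
  | cons a M ih =>
    have h₁ := count_antidiagonal_aux h ih
    have h₂ := count_antidiagonal_aux ((add_comm B A).trans h) ih
    have hswap : (M.antidiagonal.map (Prod.map id (a ::ₘ ·))).count (B, A) =
        (M.antidiagonal.map (Prod.map (a ::ₘ ·) id)).count (A, B) := by
      conv_lhs => rw [← Multiset.map_swap_antidiagonal, Multiset.map_map]
      rw [← Multiset.count_map_eq_count' _ _ Prod.swap_injective, Multiset.map_map]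
      rfl
    have hc := congrArg (Multiset.count a) h
    rw [Multiset.count_add, Multiset.count_cons_self] at hc
    rw [Multiset.antidiagonal_cons, Multiset.count_add, RTree.sym_node_cons, ← hc, ← hswap]
    linarith

lemma forestWeight_cons (a : RTree) (M : Multiset RTree) :
    forestWeight (a ::ₘ M) * (a ::ₘ M).count a = (a.sym : ℚ)⁻¹ * forestWeight M := by
  have h₁ : (a.sym : ℚ) ≠ 0 := by exact_mod_cast a.sym_pos.ne'
  have h₂ : ((RTree.node M).sym : ℚ) ≠ 0 := by exact_mod_cast (RTree.node M).sym_pos.ne'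
  have h₃ : (M.count a + 1 : ℚ) ≠ 0 := by positivity
  rw [forestWeight, forestWeight, RTree.sym_node_cons, Multiset.count_cons_self]
  push_cast
  field_simp

lemma forestWeight_mul_count_antidiagonal (A B : Multiset RTree) :
    forestWeight (A + B) * (A + B).antidiagonal.count (A, B) =
      forestWeight A * forestWeight B := by
  have h₁ : ((RTree.node A).sym : ℚ) ≠ 0 := by exact_mod_cast (RTree.node A).sym_pos.ne'
  have h₂ : ((RTree.node B).sym : ℚ) ≠ 0 := by exact_mod_cast (RTree.node B).sym_pos.ne'
  have h₃ : ((RTree.node (A + B)).sym : ℚ) ≠ 0 := by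
    exact_mod_cast (RTree.node (A + B)).sym_pos.ne'
  have h : ((A + B).antidiagonal.count (A, B) * (RTree.node A).sym * (RTree.node B).sym : ℚ) =
      (RTree.node (A + B)).sym := by exact_mod_cast count_antidiagonal_mul_sym A B _ rfl
  rw [forestWeight, forestWeight, forestWeight]
  field_simp
  linarith

/-- Multiplicativity of the weights: summing over all ways to split a forest in two amounts to
summing over pairs of forests. -/
lemma sum_forestWeight_antidiagonal {V : Type*} [AddCommGroup V] [Module ℚ V] (n : ℕ)
    (G : Multiset RTree → Multiset RTree → V) :
    ∑ M ∈ forests n, forestWeight M • (M.antidiagonal.map fun p => G p.1 p.2).sum =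
      ∑ p ∈ Finset.HasAntidiagonal.antidiagonal n, ∑ B ∈ forests p.2, forestWeight B •
        ∑ A ∈ forests p.1, forestWeight A • G A B := by
  have hL : ∀ M : Multiset RTree, forestWeight M • (M.antidiagonal.map fun p => G p.1 p.2).sum =
      ∑ p ∈ M.antidiagonal.toFinset, (forestWeight p.1 * forestWeight p.2) • G p.1 p.2 := by
    intro M
    rw [Finset.sum_multiset_map_count, Finset.smul_sum]
    refine Finset.sum_congr rfl fun p hp => ?_
    obtain rfl := Multiset.mem_antidiagonal.1 (Multiset.mem_toFinset.1 hp)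
    rw [← forestWeight_mul_count_antidiagonal, mul_smul, Nat.cast_smul_eq_nsmul]
  simp only [hL, Finset.smul_sum, smul_smul]
  simp only [Finset.sum_sigma']
  refine Finset.sum_bij' (fun x _ => ⟨((x.2.1.map RTree.size).sum, (x.2.2.map RTree.size).sum),
      x.2.2, x.2.1⟩) (fun y _ => ⟨y.2.2 + y.2.1, (y.2.2, y.2.1)⟩) ?_ ?_ ?_ ?_ ?_
  · rintro ⟨M, A, B⟩ h
    simp only [Finset.mem_sigma, mem_forests, Multiset.mem_toFinset, Multiset.mem_antidiagonal,
      Finset.HasAntidiagonal.mem_antidiagonal, and_true] at h ⊢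
    obtain ⟨rfl, rfl⟩ := h
    simp
  · rintro ⟨⟨i, j⟩, B, A⟩ h
    simp only [Finset.mem_sigma, mem_forests, Multiset.mem_toFinset, Multiset.mem_antidiagonal,
      Finset.HasAntidiagonal.mem_antidiagonal, and_true] at h ⊢
    simp [h.1, h.2.1, h.2.2]
  · rintro ⟨M, A, B⟩ h
    simp only [Finset.mem_sigma, Multiset.mem_toFinset, Multiset.mem_antidiagonal] at h
    obtain ⟨_, rfl⟩ := h
    rfl
  · rintro ⟨⟨i, j⟩, B, A⟩ h
    simp only [Finset.mem_sigma, mem_forests] at h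
    obtain ⟨_, rfl, rfl⟩ := h
    rfl
  · rintro ⟨M, A, B⟩ h
    simp [mul_comm]

/-- The sum of `G F` over all forests `F` obtained from the forest of the trees `B₊(b)`, `b ∈ Bs`,
by either adding each tree of `M` as a new component or attaching it to one of the roots of
that forest. -/
noncomputable def attachSum {V : Type*} [AddCommMonoid V] :
    List (Multiset RTree) → Multiset RTree → (Multiset RTree → V) → V
  | [], M, G => G M
  | b :: Bs, M, G =>
    (M.antidiagonal.map fun p => attachSum Bs p.1 fun F => G (RTree.node (p.2 + b) ::ₘ F)).sum

lemma attachSum_zero {V : Type*} [AddCommMonoid V] (Bs : List (Multiset RTree))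
    (G : Multiset RTree → V) : attachSum Bs 0 G = G (Bs.map RTree.node : List RTree) := by
  induction Bs generalizing G with
  | nil => rfl
  | cons b Bs ih => simp [attachSum, ih]

lemma attachSum_cons {V : Type*} [AddCommMonoid V] (Bs : List (Multiset RTree))
    (M : Multiset RTree) (G : Multiset RTree → V) (s : RTree) :
    attachSum Bs (s ::ₘ M) G = attachSum Bs M (fun F => G (s ::ₘ F)) +
      ∑ i ∈ Finset.range Bs.length, attachSum (Bs.modify i (s ::ₘ ·)) M G := by
  induction Bs generalizing M G with
  | nil => simp [attachSum]
  | cons b Bs ih =>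
    rw [List.length_cons, Finset.sum_range_succ']
    simp only [attachSum, Multiset.antidiagonal_cons, Multiset.map_add, Multiset.map_map,
      Multiset.sum_add, List.modify_succ_cons, List.modify_zero_cons, Function.comp_def,
      Prod.map_fst, Prod.map_snd, id_eq, ih, Multiset.sum_map_add, Multiset.sum_map_sum,
      Multiset.cons_add, Multiset.add_cons, Multiset.cons_swap s]
    abel

lemma card_le_of_mem_forests {n : ℕ} {M : Multiset RTree} (h : M ∈ forests n) :
    Multiset.card M ≤ n := by
  rw [mem_forests] at h
  have := Multiset.card_nsmul_le_sum (s := M.map RTree.size) (a := 1) (by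
    simp only [Multiset.mem_map]
    rintro _ ⟨t, _, rfl⟩
    exact t.size_pos)
  simpa [h] using this

/-- Marking a component of a forest. -/
lemma sum_forests_succ {V : Type*} [AddCommMonoid V] (n : ℕ)
    (H : RTree → Multiset RTree → V) :
    ∑ F ∈ forests (n + 1), ∑ t ∈ F.toFinset, H t (F.erase t) =
      ∑ p ∈ Finset.HasAntidiagonal.antidiagonal n, ∑ B ∈ forests p.2, ∑ F ∈ forests p.1,
        H (RTree.node B) F := by
  simp only [Finset.sum_sigma']
  refine Finset.sum_bij' (fun x _ => ⟨(((x.1.erase x.2).map RTree.size).sum,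
      (x.2.children.map RTree.size).sum), x.2.children, x.1.erase x.2⟩)
    (fun y _ => ⟨RTree.node y.2.1 ::ₘ y.2.2, RTree.node y.2.1⟩) ?_ ?_ ?_ ?_ ?_
  · rintro ⟨F, t⟩ h
    simp only [Finset.mem_sigma, mem_forests, Multiset.mem_toFinset,
      Finset.HasAntidiagonal.mem_antidiagonal, and_true] at h ⊢
    obtain ⟨h, ht⟩ := h
    rw [← Multiset.cons_erase ht, Multiset.map_cons, Multiset.sum_cons, ← t.node_children,
      RTree.size_node, t.node_children] at h
    omega
  · rintro ⟨⟨i, j⟩, B, F⟩ h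
    simp only [Finset.mem_sigma, mem_forests, Multiset.mem_toFinset,
      Finset.HasAntidiagonal.mem_antidiagonal] at h ⊢
    simp only [Multiset.map_cons, Multiset.sum_cons, RTree.size_node, Multiset.mem_cons, true_or,
      and_true]
    omega
  · rintro ⟨F, t⟩ h
    simp only [Finset.mem_sigma, Multiset.mem_toFinset] at h
    simp [RTree.node_children, Multiset.cons_erase h.2]
  · rintro ⟨⟨i, j⟩, B, F⟩ h
    simp only [Finset.mem_sigma, mem_forests] at h
    obtain ⟨_, rfl, rfl⟩ := h
    simp [RTree.children_node]
  · rintro ⟨F, t⟩ h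
    simp [RTree.node_children]

lemma sum_antidiagonal_shift {V : Type*} [AddCommMonoid V] (j m : ℕ) (f : ℕ → ℕ → V)
    (hf : ∀ k < m, ∀ l, f k l = 0) :
    ∑ p ∈ Finset.HasAntidiagonal.antidiagonal (j + m), f p.1 p.2 =
      ∑ p ∈ Finset.HasAntidiagonal.antidiagonal j, f (p.1 + m) p.2 := by
  rw [Finset.Nat.sum_antidiagonal_eq_sum_range_succ f,
    Finset.Nat.sum_antidiagonal_eq_sum_range_succ fun k l => f (k + m) l,
    show (j + m).succ = m + j.succ by omega, Finset.sum_range_add,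
    Finset.sum_eq_zero fun k hk => hf k (Finset.mem_range.1 hk) _, zero_add]
  refine Finset.sum_congr rfl fun k _ => ?_
  congr 1 <;> omega

lemma sum_forestWeight_attachSum {V : Type*} [AddCommGroup V] [Module ℚ V] (m j : ℕ)
    (G : Multiset RTree → V) :
    ∑ M ∈ forests j, forestWeight M • attachSum (List.replicate m 0) M G =
      (m.factorial : ℚ) • ∑ F ∈ forests (j + m),
        ((Multiset.card F).choose m * forestWeight F) • G F := by
  induction m generalizing j G with
  | zero => simp [attachSum]
  | succ m ih =>
    simp only [List.replicate_succ, attachSum, add_zero]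
    rw [sum_forestWeight_antidiagonal j
      fun A B => attachSum (List.replicate m 0) A fun F => G (RTree.node B ::ₘ F)]
    simp only [ih]
    have hR : ∀ F : Multiset RTree,
        ((m + 1 : ℚ) * ((Multiset.card F).choose (m + 1) * forestWeight F)) • G F =
          ∑ t ∈ F.toFinset, ((t.sym : ℚ)⁻¹ * (((Multiset.card (F.erase t)).choose m : ℚ) *
            forestWeight (F.erase t))) • G (t ::ₘ F.erase t) := by
      intro F
      have ht : ∀ t ∈ F.toFinset, ((t.sym : ℚ)⁻¹ * (((Multiset.card (F.erase t)).choose m : ℚ) *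
            forestWeight (F.erase t))) • G (t ::ₘ F.erase t) =
          ((F.count t : ℚ) * (((Multiset.card F - 1).choose m : ℚ) * forestWeight F)) • G F := by
        intro t ht
        rw [Multiset.mem_toFinset] at ht
        have h := forestWeight_cons t (F.erase t)
        rw [Multiset.cons_erase ht] at h ⊢
        rw [Multiset.card_erase_of_mem ht, mul_left_comm, ← h, Nat.pred_eq_sub_one]
        ring_nf
      rw [Finset.sum_congr rfl ht, ← Finset.sum_smul, ← Finset.sum_mul, ← Nat.cast_sum,
        Multiset.toFinset_sum_count_eq]
      congr 1
      cases h : Multiset.card F with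
      | zero => simp
      | succ k =>
        have := Nat.add_one_mul_choose_eq k m
        have h' : ((k + 1 : ℕ) : ℚ) * (k.choose m : ℚ) = ((k + 1).choose (m + 1) : ℚ) * (m + 1) := by
          exact_mod_cast this
        rw [Nat.add_sub_cancel, ← mul_assoc, ← mul_assoc, h']
        ring
    rw [Nat.factorial_succ, Nat.cast_mul, mul_comm, mul_smul, Finset.smul_sum]
    simp only [smul_smul, Nat.cast_succ, hR]
    rw [← add_assoc, sum_forests_succ (j + m) fun t F => ((t.sym : ℚ)⁻¹ *
      (((Multiset.card F).choose m : ℚ) * forestWeight F)) • G (t ::ₘ F),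
      sum_antidiagonal_shift j m fun k l => ∑ B ∈ forests l, ∑ F ∈ forests k,
        (((RTree.node B).sym : ℚ)⁻¹ * (((Multiset.card F).choose m : ℚ) * forestWeight F)) •
          G (RTree.node B ::ₘ F)]
    · simp only [Finset.smul_sum, smul_smul, forestWeight]
      refine Finset.sum_congr rfl fun p _ => Finset.sum_congr rfl fun B _ =>
        Finset.sum_congr rfl fun F _ => ?_
      congr 1
      ring
    · intro k hk l
      refine Finset.sum_eq_zero fun B _ => Finset.sum_eq_zero fun F hF => ?_
      rw [Nat.choose_eq_zero_of_lt ((card_le_of_mem_forests hF).trans_lt hk)]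
      simp

lemma sum_map_sections_replicate_succ {α V : Type*} [AddCommMonoid V] (L : List α) (k : ℕ)
    (f : List α → V) :
    ((List.replicate (k + 1) L).sections.map f).sum =
      (L.map fun a => ((List.replicate k L).sections.map fun s => f (a :: s)).sum).sum := by
  have h := Multiset.sum_map_sum_map (L : Multiset α)
    ((List.replicate k L).sections : Multiset (List α)) (f := fun a s => f (a :: s))
  simp only [Multiset.map_coe, Multiset.sum_coe] at h
  rw [h, List.replicate_succ, List.sections]
  generalize (List.replicate k L).sections = S
  induction S with
  | nil => rfl
  | cons s S ih => simp [Function.comp_def, ih]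

namespace PTree

lemma positionsList_replicate (i m : ℕ) :
    positionsList i (List.replicate m (node [])) = (List.range' i m).map fun j => [j] := by
  induction m generalizing i with
  | zero => simp [positionsList]
  | succ m ih => simp [List.replicate_succ, positionsList, positions, ih, List.range'_succ]

lemma positions_corolla (m : ℕ) :
    positions (node (List.replicate m (node []))) = [] :: (List.range m).map fun j => [j] := by
  rw [positions, positionsList_replicate, List.range_eq_range']

lemma attachAt_singleton (s : PTree) (Bs : List (List PTree)) (A : List PTree) {i : ℕ}
    (hi : i < Bs.length) :
    attachAt s (node (Bs.map node ++ A)) [i] = node ((Bs.modify i (· ++ [s])).map node ++ A) := by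
  have h : (Bs.map node ++ A)[i]! = node Bs[i] := by
    rw [getElem!_pos _ _ (by simp; omega), List.getElem_append_left (by simpa using hi),
      List.getElem_map]
  rw [attachAt, h, attachAt, List.set_append_left _ _ (by simpa using hi), List.modify_eq_set,
    List.map_set]
  simp [hi]

end PTree

lemma sum_attachMany (l : List PTree) (Bs : List (List PTree)) (A : List PTree) :
    ((List.replicate l.length ([] :: (List.range Bs.length).map fun j => [j])).sections.map
      fun ps => Finsupp.single
        (toR (PTree.attachMany (.node (Bs.map PTree.node ++ A)) (ps.zip l))) (1 : ℚ)).sum =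
    attachSum (Bs.map fun b => ((b.map toR : List RTree) : Multiset RTree))
      (l.map toR : List RTree)
      fun F => Finsupp.single (RTree.node ((A.map toR : List RTree) + F)) (1 : ℚ) := by
  induction l generalizing Bs A with
  | nil =>
    rw [List.map_nil, Multiset.coe_nil, attachSum_zero]
    simp only [List.length_nil, List.replicate_zero, List.sections, List.map_cons, List.map_nil,
      List.sum_cons, List.sum_nil, add_zero, List.zip_nil_right, PTree.attachMany]
    rw [← RTree.node_map_toR, List.map_append, add_comm, Multiset.coe_add, List.map_map,
      List.map_map]
    simp only [Function.comp_def, RTree.node_map_toR]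
  | cons s l ih =>
    rw [List.length_cons, sum_map_sections_replicate_succ, List.map_cons (f := toR),
      ← Multiset.cons_coe, attachSum_cons, List.map_cons, List.sum_cons, List.map_map,
      Finset.sum_range,
      ← List.sum_ofFn]
    congr 1
    · simp only [List.zip_cons_cons, PTree.attachMany, PTree.attachAt, List.append_assoc]
      rw [ih Bs (A ++ [s])]
      congr 1
      funext F
      rw [List.map_append, ← Multiset.coe_add, add_assoc]
      simp
    · congr 1
      refine List.ext_getElem (by simp) fun i h₁ h₂ => ?_
      have hi : i < Bs.length := by simpa using h₁
      have h := ih (Bs.modify i (· ++ [s])) A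
      rw [List.length_modify] at h
      simp only [List.getElem_map, List.getElem_range, Function.comp_apply, List.zip_cons_cons,
        PTree.attachMany, PTree.attachAt_singleton s Bs A hi, List.getElem_ofFn, h]
      congr 1
      refine List.ext_getElem (by simp) fun k _ _ => ?_
      simp only [List.getElem_map, List.getElem_modify]
      split_ifs
      · rw [List.map_append, ← Multiset.coe_add]
        simp [add_comm]
      · rfl

/-- The corolla with `m` leaves. -/
noncomputable def corolla (m : ℕ) : RTree := toR (.node (List.replicate m (.node [])))

lemma node_replicate_bullet (m : ℕ) :
    RTree.node (Multiset.replicate m (toR (.node []))) = corolla m := by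
  rw [corolla, ← RTree.node_map_toR (List.replicate _ _), List.map_replicate, Multiset.coe_replicate]

lemma out_corolla (m : ℕ) : (corolla m).out = .node (List.replicate m (.node [])) := by
  have h := congrArg RTree.children (corolla m).toR_out
  revert h
  cases (corolla m).out with
  | node l =>
    intro h
    rw [RTree.children_toR, ← node_replicate_bullet, RTree.children_node,
      ← Multiset.coe_replicate, Multiset.coe_eq_coe, List.perm_replicate] at h
    rw [PTree.node.injEq, List.eq_replicate_iff]
    refine ⟨by simpa using congrArg List.length h, fun t ht => ?_⟩
    have ht' := congrArg RTree.children (List.eq_of_mem_replicate (h ▸ List.mem_map_of_mem ht))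
    cases t with
    | node l => simpa [RTree.children_toR] using ht'

lemma glMul_corolla (M : Multiset RTree) (m : ℕ) :
    glMul ℚ (RTree.node M) (corolla m) =
      attachSum (List.replicate m 0) M fun F => Finsupp.single (RTree.node F) 1 := by
  have h := congrArg RTree.children (RTree.node M).toR_out
  rw [glMul, out_corolla]
  revert h
  cases (RTree.node M).out with
  | node l =>
    intro h
    rw [RTree.children_node, RTree.children_toR] at h
    have key := sum_attachMany l (List.replicate m []) []
    simp only [List.length_replicate, List.map_replicate, List.append_nil, List.map_nil,
      Multiset.coe_nil, zero_add, h] at key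
    rw [glMulP, PTree.positions_corolla, key]

lemma glMulF_kappa_corolla (j m : ℕ) (c : ℚ) :
    glMulF (kappa j) (Finsupp.single (corolla m) c) = (c * m.factorial) •
      ∑ F ∈ forests (j + m), ((Multiset.card F).choose m * forestWeight F) •
        Finsupp.single (RTree.node F) 1 := by
  rw [mul_smul, ← sum_forestWeight_attachSum, kappa_eq_sum_forests, glMulF,
    ← Finsupp.sum_finsetSum_index (by simp) (by
      intro a x y
      rw [← Finsupp.sum_add]
      simp [add_mul, add_smul])]
  simp only [Finsupp.sum_single_index, mul_zero, zero_smul,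
    glMul_corolla, Finset.smul_sum, smul_smul, mul_comm]

lemma sum_neg_one_pow_mul_choose (n r : ℕ) (h₀ : 0 < r) (hr : r ≤ n + 1) :
    ∑ j ∈ Finset.range (n + 1), (-1 : ℚ) ^ j * r.choose (n - j) = if r = n + 1 then 1 else 0 := by
  have h := Int.alternating_sum_range_choose_of_ne h₀.ne'
  have h' : ∑ m ∈ Finset.range (n + 2), (-1 : ℚ) ^ m * r.choose m = 0 := by
    rw [← Finset.sum_subset (s₁ := Finset.range (r + 1))
      (by intro x; simp only [Finset.mem_range]; omega) (by
        intro x _ hx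
        rw [Nat.choose_eq_zero_of_lt (by simpa using hx)]
        simp)]
    exact_mod_cast h
  rw [Finset.sum_range_succ] at h'
  have e : ∑ j ∈ Finset.range (n + 1), (-1 : ℚ) ^ j * r.choose (n - j) =
      (-1) ^ n * ∑ m ∈ Finset.range (n + 1), (-1 : ℚ) ^ m * r.choose m := by
    rw [← Finset.sum_range_reflect, Finset.mul_sum]
    refine Finset.sum_congr rfl fun j hj => ?_
    have hj : j ≤ n := by simpa [Nat.lt_succ_iff] using hj
    rw [show n + 1 - 1 - j = n - j by omega, Nat.sub_sub_self hj, ← mul_assoc, ← pow_add,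
      show n + j = n - j + 2 * j by omega, pow_add _ (n - j), pow_mul]
    simp
  rw [e, eq_neg_of_add_eq_zero_left h', pow_succ]
  split_ifs with hrn
  · rw [hrn, Nat.choose_self]
    have : ((-1 : ℚ) ^ n) * (-1) ^ n = 1 := by rw [← mul_pow]; simp
    linear_combination this
  · rw [Nat.choose_eq_zero_of_lt (by omega)]
    simp

lemma eq_replicate_of_mem_forests {n : ℕ} {F : Multiset RTree} (hF : F ∈ forests n)
    (h : Multiset.card F = n) : F = Multiset.replicate n (toR (.node [])) := by
  refine Multiset.eq_replicate.2 ⟨h, fun t ht => ?_⟩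
  obtain ⟨F, rfl⟩ := Multiset.exists_cons_of_mem ht
  have h₁ := mem_forests.1 hF
  have h₂ := card_le_of_mem_forests (mem_forests.2 (rfl : (F.map RTree.size).sum = _))
  rw [Multiset.map_cons, Multiset.sum_cons] at h₁
  rw [Multiset.card_cons] at h
  have h₃ : t.children ∈ forests 0 := by
    rw [mem_forests]
    rw [← t.node_children, RTree.size_node] at h₁
    omega
  have h₄ := card_le_of_mem_forests h₃
  rw [← t.node_children, Multiset.card_eq_zero.1 (Nat.le_zero.1 h₄)]
  exact RTree.node_map_toR []

lemma forestWeight_replicate_bullet (n : ℕ) :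
    forestWeight (Multiset.replicate n (toR (.node []))) = (n.factorial : ℚ)⁻¹ := by
  have h : (toR (.node [])).sym = 1 := by
    rw [RTree.sym_toR, PTree.symOrder_node]; simp
  rw [forestWeight]
  congr 2
  induction n with
  | zero => simp [RTree.sym_node_zero]
  | succ n ih =>
    rw [Multiset.replicate_succ, RTree.sym_node_cons, ih, h, Multiset.count_replicate_self,
      Nat.factorial_succ, one_mul]

lemma eps_eq_single (n : ℕ) :
    eps n = Finsupp.single (corolla n) (n.factorial : ℚ)⁻¹ := by
  induction n using Nat.strong_induction_on with
  | _ n ih =>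
    cases n with
    | zero => simp [eps, corolla, RTree.bullet]
    | succ n =>
      have hterm : ∀ j ∈ Finset.range (n + 1),
          ((-1 : ℚ)) ^ j • glMulF (kappa (j + 1)) (eps (n - j)) =
            ∑ F ∈ forests (n + 1), (((-1 : ℚ) ^ j * (Multiset.card F).choose (n - j)) *
              forestWeight F) • Finsupp.single (RTree.node F) 1 := by
        intro j hj
        have hj : j ≤ n := by simpa [Nat.lt_succ_iff] using hj
        have hne : ((n - j).factorial : ℚ) ≠ 0 := by exact_mod_cast (n - j).factorial_ne_zero
        rw [ih (n - j) (by omega), glMulF_kappa_corolla, inv_mul_cancel₀ hne, one_smul,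
          show j + 1 + (n - j) = n + 1 by omega, Finset.smul_sum]
        simp only [smul_smul, mul_assoc]
      rw [eps, Finset.sum_congr rfl hterm, Finset.sum_comm]
      simp only [← Finset.sum_smul, ← Finset.sum_mul]
      rw [Finset.sum_eq_single (Multiset.replicate (n + 1) (toR (.node [])))]
      · rw [sum_neg_one_pow_mul_choose _ _ (by simp) (by simp), node_replicate_bullet,
          forestWeight_replicate_bullet]
        simp
      · intro F hF hne
        have h₀ : 0 < Multiset.card F := by
          rw [Multiset.card_pos]
          rintro rfl
          simp [mem_forests] at hF
        rw [sum_neg_one_pow_mul_choose _ _ h₀ (card_le_of_mem_forests hF),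
          if_neg fun h => hne (eq_replicate_of_mem_forests hF h)]
        simp
      · intro h
        refine absurd (mem_forests.2 ?_) h
        simp [RTree.size_toR, PTree.size_node, add_comm]

/-- For the elements `ε_n` of `ℚT` defined by `ε_0 = •` and
`ε_n = Σ_{j=1}^n (−1)^{j−1} κ_j ∘ ε_{n−j}`, one has `n!·ε_n = t_{1ⁿ}`, the
corolla whose root has exactly `n` children, each a leaf. -/
theorem eps_eq_corolla (n : ℕ) :
    (n.factorial : ℚ) • eps n
      = Finsupp.single (toR (PTree.node (List.replicate n (PTree.node [])))) 1 := by
  have h : (n.factorial : ℚ) ≠ 0 := by exact_mod_cast n.factorial_ne_zero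
  rw [eps_eq_single, Finsupp.smul_single, smul_eq_mul, mul_inv_cancel₀ h, corolla]
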